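/- arXiv:2004.06962 — 2 statements merged into one kernel-verified Lean document; each statement's English description precedes it below -/
import Mathlib

section
/- Let b : [0,∞) → ℂ be differentiable and a : [0,∞) → ℂ be continuous, such that for every t ≥ 0, Im( i·b'(t)·conj(b(t)) − (1/2)·a(t)·|b(t)|² ) = 0. Then for every t ≥ 0, |b(t)| = |b(0)|·exp( (1/2)·Im(∫₀ᵗ a(s) ds) ). -/
open Set

/-- **Modulus of the Gaussian amplitude.**
If `b : [0,∞) → ℂ` is differentiable, `a : [0,∞) → ℂ` is continuous, and for every
`t ≥ 0` the quantity `i b'(t) conj(b(t)) − ½ a(t) |b(t)|²` has vanishing imaginary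
part, then `|b(t)| = |b(0)| exp(½ Im ∫₀ᵗ a(s) ds)` for every `t ≥ 0`. -/
theorem gaussian_amplitude_modulus
    (b b' a : ℝ → ℂ)
    (hb : ∀ t ∈ Ici (0:ℝ), HasDerivWithinAt b (b' t) (Ici 0) t)
    (ha : ContinuousOn a (Ici 0))
    (h : ∀ t ∈ Ici (0:ℝ),
      (Complex.I * b' t * (starRingEnd ℂ) (b t)
        - (1 / 2 : ℂ) * a t * ((‖b t‖ ^ 2 : ℝ) : ℂ)).im = 0) :
    ∀ t ∈ Ici (0:ℝ),
      ‖b t‖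
        = ‖b 0‖ * Real.exp ((1 / 2) * (∫ s in (0:ℝ)..t, a s).im) := by
  have hA : Continuous fun s : ℝ => a (max s 0) :=
    ha.comp_continuous (continuous_id.max continuous_const) fun s => le_max_right s 0
  let F : ℝ → ℂ := fun t => ∫ s in (0:ℝ)..t, a (max s 0)
  have hF_eq : ∀ t ∈ Ici (0:ℝ), ∫ s in (0:ℝ)..t, a s = F t := by
    intro t ht
    refine intervalIntegral.integral_congr fun s hs => ?_
    rw [uIcc_of_le (mem_Ici.1 ht)] at hs
    simp only [max_eq_left hs.1]
  have hF_deriv : ∀ t, HasDerivAt (fun t => (F t).im) (a (max t 0)).im t := fun t =>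
    Complex.imCLM.hasFDerivAt.comp_hasDerivAt t (hA.integral_hasStrictDerivAt 0 t).hasDerivAt
  have hG : ∀ t ∈ Ici (0:ℝ),
      HasDerivWithinAt (fun t => ‖b t‖ ^ 2 * Real.exp (-(F t).im)) 0 (Ici 0) t := by
    intro t ht
    refine ((hb t ht).norm_sq.mul (hF_deriv t).hasDerivWithinAt.neg.exp).congr_deriv ?_
    have ht' := h t ht
    rw [max_eq_left (mem_Ici.1 ht)]
    rw [Complex.sub_im, Complex.im_mul_ofReal] at ht'
    rw [Complex.inner]
    simp only [Complex.mul_im, Complex.mul_re, Complex.I_re, Complex.I_im, Complex.conj_re,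
      Complex.conj_im] at ht' ⊢
    norm_num at ht'
    simp only [Pi.neg_apply]
    linear_combination (2 * Real.exp (-(F t).im)) * ht'
  intro t ht
  have hconst := constant_of_has_deriv_right_zero (a := 0) (b := t)
    (fun x hx => ((hG x hx.1).continuousWithinAt).mono Icc_subset_Ici_self)
    (fun x hx => (hG x hx.1).mono (Ici_subset_Ici.2 hx.1)) t (right_mem_Icc.2 ht)
  have hF0 : F 0 = 0 := intervalIntegral.integral_same
  simp only [hF0, Complex.zero_im, neg_zero, Real.exp_zero, mul_one] at hconst
  rw [hF_eq t ht]
  refine (sq_eq_sq₀ (norm_nonneg _) (by positivity)).1 ?_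
  rw [mul_pow, ← hconst, ← Real.exp_nat_mul, mul_assoc, ← Real.exp_add]
  push_cast
  ring_nf
  simp
end

section
/- Let λ ∈ ℝ with λ ≠ 0, μ > 0, α₀ > 0, β₀ ∈ ℝ and b₀ > 0. Let r : [0,∞) → ℝ be twice continuously differentiable with r(t) > 0 for all t, satisfying r''(t) = α₀²/r(t)³ + 2λα₀/r(t) − μ·r'(t), r(0) = 1, r'(0) = −β₀. Let φ : [0,∞) → ℝ be continuously differentiable and satisfy φ'(t) + μ·φ(t) = −α₀/(2r(t)²) − λ·log(b₀²) + λ·log(r(t)) for all t ≥ 0. Define ψ : [0,∞) × ℝ → ℂ by ψ(t,x) = (b₀/√(r(t)))·exp( iφ(t) − α₀·x²/(2r(t)²) + i·r'(t)·x²/(2r(t)) ). Then for all t > 0 and x ∈ ℝ: i·∂ₜψ(t,x) + (1/2)·∂ₓₓψ(t,x) = λ·ψ(t,x)·log(|ψ(t,x)|²) + μ·( φ(t) + r'(t)·x²/(2r(t)) )·ψ(t,x). -/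
open Set

/-- The Gaussian ansatz `ψ(t,x) = (b₀/√r(t)) exp(iφ(t) − α₀x²/(2r(t)²) + i r'(t)x²/(2r(t)))`. -/
noncomputable def gaussianAnsatz (b0 a0 : ℝ) (r r' φ : ℝ → ℝ) (t x : ℝ) : ℂ :=
  ((b0 / Real.sqrt (r t) : ℝ) : ℂ) *
    Complex.exp (Complex.I * ((φ t : ℝ) : ℂ)
      - ((a0 * x ^ 2 / (2 * (r t) ^ 2) : ℝ) : ℂ)
      + Complex.I * ((r' t * x ^ 2 / (2 * r t) : ℝ) : ℂ))

/-- The logarithmic derivative in time of the Gaussian ansatz. -/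
theorem hasDerivWithinAt_gaussianAnsatz_time {b0 a0 : ℝ} {r r' φ : ℝ → ℝ} {s : Set ℝ}
    {t r'' φ' : ℝ} (hpos : 0 < r t) (hr : HasDerivWithinAt r (r' t) s t)
    (hr' : HasDerivWithinAt r' r'' s t) (hφ : HasDerivWithinAt φ φ' s t) (x : ℝ) :
    HasDerivWithinAt (fun τ => gaussianAnsatz b0 a0 r r' φ τ x)
      (((-(r' t / (2 * r t)) + a0 * x ^ 2 * r' t / (r t) ^ 3 : ℝ)
        + Complex.I * ((φ' + x ^ 2 / 2 * (r'' / r t - (r' t) ^ 2 / (r t) ^ 2) : ℝ) : ℂ))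
        * gaussianAnsatz b0 a0 r r' φ t x) s t := by
  have hne := hpos.ne'
  have hsq : 0 < √(r t) := Real.sqrt_pos.2 hpos
  have hamp : HasDerivWithinAt (fun τ => b0 / √(r τ))
      (-(r' t / (2 * r t)) * (b0 / √(r t))) s t := by
    refine ((hasDerivWithinAt_const t s b0).fun_div (hr.sqrt hne) hsq.ne').congr_deriv ?_
    field_simp
    rw [Real.sq_sqrt hpos.le]
    ring
  have hwidth : HasDerivWithinAt (fun τ => a0 * x ^ 2 / (2 * (r τ) ^ 2))
      (-(a0 * x ^ 2 * r' t / (r t) ^ 3)) s t := by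
    refine ((hasDerivWithinAt_const t s (a0 * x ^ 2)).fun_div
      ((hr.fun_pow 2).const_mul 2) (by positivity)).congr_deriv ?_
    norm_num
    field_simp
  have hchirp : HasDerivWithinAt (fun τ => r' τ * x ^ 2 / (2 * r τ))
      (x ^ 2 / 2 * (r'' / r t - (r' t) ^ 2 / (r t) ^ 2)) s t := by
    refine ((hr'.mul_const (x ^ 2)).fun_div (hr.const_mul 2) (by positivity)).congr_deriv ?_
    field_simp
  have h := hamp.ofReal_comp.fun_mul
    (((hφ.ofReal_comp.const_mul Complex.I).fun_sub hwidth.ofReal_comp).fun_add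
      (hchirp.ofReal_comp.const_mul Complex.I)).cexp
  refine h.congr_deriv ?_
  simp only [gaussianAnsatz]
  push_cast
  ring

/-- The logarithmic derivative in space of the Gaussian ansatz. -/
theorem hasDerivAt_gaussianAnsatz_space (b0 a0 : ℝ) (r r' φ : ℝ → ℝ) (t x : ℝ) :
    HasDerivAt (fun y => gaussianAnsatz b0 a0 r r' φ t y)
      (((-(a0 / (r t) ^ 2) : ℝ) + Complex.I * ((r' t / r t : ℝ) : ℂ)) * (x : ℂ)
        * gaussianAnsatz b0 a0 r r' φ t x) x := by
  have hwidth : HasDerivAt (fun y : ℝ => a0 * y ^ 2 / (2 * (r t) ^ 2))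
      (a0 / (r t) ^ 2 * x) x := by
    refine (((hasDerivAt_pow 2 x).const_mul a0).div_const (2 * (r t) ^ 2)).congr_deriv ?_
    norm_num
    ring
  have hchirp : HasDerivAt (fun y : ℝ => r' t * y ^ 2 / (2 * r t)) (r' t / r t * x) x := by
    refine (((hasDerivAt_pow 2 x).const_mul (r' t)).div_const (2 * r t)).congr_deriv ?_
    norm_num
    ring
  have h := ((((hasDerivAt_const x (Complex.I * (φ t : ℂ))).fun_sub hwidth.ofReal_comp).fun_add
    (hchirp.ofReal_comp.const_mul Complex.I)).cexp).const_mul ((b0 / √(r t) : ℝ) : ℂ)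
  refine h.congr_deriv ?_
  simp only [gaussianAnsatz]
  push_cast
  ring

theorem deriv_deriv_gaussianAnsatz_space (b0 a0 : ℝ) (r r' φ : ℝ → ℝ) (t x : ℝ) :
    deriv (deriv (fun y => gaussianAnsatz b0 a0 r r' φ t y)) x
      = (((-(a0 / (r t) ^ 2) : ℝ) + Complex.I * ((r' t / r t : ℝ) : ℂ))
          + (((-(a0 / (r t) ^ 2) : ℝ) + Complex.I * ((r' t / r t : ℝ) : ℂ)) * (x : ℂ)) ^ 2)
        * gaussianAnsatz b0 a0 r r' φ t x := by
  rw [funext fun y => (hasDerivAt_gaussianAnsatz_space b0 a0 r r' φ t y).deriv]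
  have h := ((hasDerivAt_id x).ofReal_comp.const_mul
    ((-(a0 / (r t) ^ 2) : ℝ) + Complex.I * ((r' t / r t : ℝ) : ℂ))).fun_mul
    (hasDerivAt_gaussianAnsatz_space b0 a0 r r' φ t x)
  refine h.deriv.trans ?_
  simp only [id, Complex.ofReal_one]
  ring

theorem log_sq_norm_gaussianAnsatz {b0 : ℝ} (a0 : ℝ) {r : ℝ → ℝ} (r' φ : ℝ → ℝ) {t : ℝ}
    (x : ℝ) (hb0 : b0 ≠ 0) (hpos : 0 < r t) :
    Real.log (‖gaussianAnsatz b0 a0 r r' φ t x‖ ^ 2)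
      = Real.log (b0 ^ 2) - Real.log (r t) - a0 * x ^ 2 / (r t) ^ 2 := by
  have hre : (Complex.I * ((φ t : ℝ) : ℂ) - ((a0 * x ^ 2 / (2 * (r t) ^ 2) : ℝ) : ℂ)
      + Complex.I * ((r' t * x ^ 2 / (2 * r t) : ℝ) : ℂ)).re
      = -(a0 * x ^ 2 / (2 * (r t) ^ 2)) := by
    simp only [Complex.add_re, Complex.sub_re, Complex.re_mul_ofReal, Complex.I_re,
      Complex.ofReal_re]
    ring
  rw [gaussianAnsatz, norm_mul, Complex.norm_exp, hre, Complex.norm_real, mul_pow,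
    Real.norm_eq_abs, sq_abs, div_pow, Real.sq_sqrt hpos.le,
    Real.log_mul (by positivity) (by positivity), Real.log_div (by positivity) hpos.ne',
    Real.log_pow (Real.exp _) 2, Real.log_exp]
  have := hpos.ne'
  field_simp
  push_cast
  ring

/-- **Propagation of Gaussian data for the Schrödinger–Langevin equation.**
If `r` solves the width ODE `r'' = α₀²/r³ + 2λα₀/r − μ r'` with `r 0 = 1`, `r' 0 = −β₀`,
and the phase `φ` solves `φ' + μφ = −α₀/(2r²) − λ log(b₀²) + λ log r`, then the Gaussian
`ψ(t,x) = (b₀/√r(t)) exp(iφ(t) − α₀x²/(2r(t)²) + i r'(t)x²/(2r(t)))` satisfies, for all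
`t > 0` and `x ∈ ℝ`,
`i ∂ₜψ + ½ ∂ₓₓψ = λ ψ log|ψ|² + μ (φ(t) + r'(t)x²/(2r(t))) ψ`. -/
theorem gaussian_propagation_schrodinger_langevin
    (lam mu a0 b0' b0 : ℝ) (hlam : lam ≠ 0) (hmu : 0 < mu) (ha0 : 0 < a0) (hb0 : 0 < b0)
    (r r' r'' φ φ' : ℝ → ℝ)
    (hpos : ∀ t ∈ Ici (0:ℝ), 0 < r t)
    (hr1 : ∀ t ∈ Ici (0:ℝ), HasDerivWithinAt r (r' t) (Ici 0) t)
    (hr2 : ∀ t ∈ Ici (0:ℝ), HasDerivWithinAt r' (r'' t) (Ici 0) t)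
    (hrcont : ContinuousOn r'' (Ici 0))
    (hode : ∀ t ∈ Ici (0:ℝ),
      r'' t = a0 ^ 2 / (r t) ^ 3 + 2 * lam * a0 / r t - mu * r' t)
    (hr0 : r 0 = 1) (hr'0 : r' 0 = -b0')
    (hφ1 : ∀ t ∈ Ici (0:ℝ), HasDerivWithinAt φ (φ' t) (Ici 0) t)
    (hφcont : ContinuousOn φ' (Ici 0))
    (hφode : ∀ t ∈ Ici (0:ℝ),
      φ' t + mu * φ t = -(a0 / (2 * (r t) ^ 2)) - lam * Real.log (b0 ^ 2)
        + lam * Real.log (r t)) :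
    ∀ t ∈ Ioi (0:ℝ), ∀ x : ℝ,
      Complex.I * derivWithin (fun s => gaussianAnsatz b0 a0 r r' φ s x) (Ici 0) t
        + (1 / 2 : ℂ) * deriv (deriv (fun y => gaussianAnsatz b0 a0 r r' φ t y)) x
      = (lam : ℂ) * gaussianAnsatz b0 a0 r r' φ t x
          * ((Real.log (‖gaussianAnsatz b0 a0 r r' φ t x‖ ^ 2) : ℝ) : ℂ)
        + (mu : ℂ) * ((φ t + r' t * x ^ 2 / (2 * r t) : ℝ) : ℂ)
          * gaussianAnsatz b0 a0 r r' φ t x := by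
  intro t ht x
  have ht' : t ∈ Ici (0 : ℝ) := mem_Ici.2 (le_of_lt ht)
  have hp := hpos t ht'
  have hφt : φ' t = -(mu * φ t) - a0 / (2 * (r t) ^ 2) - lam * Real.log (b0 ^ 2)
      + lam * Real.log (r t) := by linarith [hφode t ht']
  rw [(hasDerivWithinAt_gaussianAnsatz_time hp (hr1 t ht') (hr2 t ht') (hφ1 t ht') x).derivWithin
      (uniqueDiffOn_Ici 0 t ht'), deriv_deriv_gaussianAnsatz_space,
    log_sq_norm_gaussianAnsatz a0 r' φ x hb0.ne' hp, hφt, hode t ht']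
  have hne : (r t : ℂ) ≠ 0 := Complex.ofReal_ne_zero.2 hp.ne'
  generalize gaussianAnsatz b0 a0 r r' φ t x = ψ
  generalize Real.log (b0 ^ 2) = L
  generalize Real.log (r t) = M
  push_cast
  field_simp
  ring_nf
  simp only [Complex.I_sq]
  ring
end
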